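/- Unconditional energy stability of the convex-splitting (energy splitting) time discretization of the Cahn–Hilliard equation: let Ψ = Ψ_c + Ψ_e with Ψ_c, -Ψ_e : ℝ → ℝ convex and C¹, let ε > 0, τ > 0, and let φⁿ, φⁿ⁺¹, μ ∈ C^∞(𝕋^d) satisfy the semi-implicit scheme (φⁿ⁺¹ - φⁿ)/τ = Δμ and μ = Ψ_c′(φⁿ⁺¹) + Ψ_e′(φⁿ) - ε² Δφⁿ⁺¹ on the torus 𝕋^d. Then the Ginzburg–Landau energy is nonincreasing: E(φⁿ⁺¹) ≤ E(φⁿ), regardless of the step size τ. -/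

import Mathlib

open MeasureTheory

/-- The `i`-th partial derivative of a scalar function on `ℝ^d`. -/
noncomputable def pd {d : ℕ} (i : Fin d) (f : EuclideanSpace ℝ (Fin d) → ℝ)
    (x : EuclideanSpace ℝ (Fin d)) : ℝ :=
  fderiv ℝ f x (EuclideanSpace.single i 1)

/-- The fundamental cell `[0,1]^d` of the torus `𝕋^d`. -/
def unitCube (d : ℕ) : Set (EuclideanSpace ℝ (Fin d)) :=
  {x | ∀ i, x i ∈ Set.Icc (0 : ℝ) 1}


theorem pd_contDiff {d : ℕ} (i : Fin d) {f : EuclideanSpace ℝ (Fin d) → ℝ}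
    (hf : ContDiff ℝ (⊤ : ℕ∞) f) : ContDiff ℝ (⊤ : ℕ∞) (fun y => pd i f y) := by
  unfold pd
  exact (hf.fderiv_right (m := ((⊤ : ℕ∞) : WithTop ℕ∞)) (by simp)).clm_apply contDiff_const

theorem pd_per {d : ℕ} (i : Fin d) {f : EuclideanSpace ℝ (Fin d) → ℝ}
    (hf : ∀ x i, f (x + EuclideanSpace.single i 1) = f x) (x : EuclideanSpace ℝ (Fin d))
    (j : Fin d) : pd i f (x + EuclideanSpace.single j 1) = pd i f x := by
  unfold pd
  rw [← fderiv_comp_add_right]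
  simp only [hf]

theorem pd_mul {d : ℕ} (i : Fin d) {f g : EuclideanSpace ℝ (Fin d) → ℝ}
    (hf : ContDiff ℝ (⊤ : ℕ∞) f) (hg : ContDiff ℝ (⊤ : ℕ∞) g) (x : EuclideanSpace ℝ (Fin d)) :
    pd i (fun y => f y * g y) x = f x * pd i g x + g x * pd i f x := by
  unfold pd
  rw [fderiv_fun_mul (hf.differentiable (by simp) x) (hg.differentiable (by simp) x)]
  simp

theorem pd_sub {d : ℕ} (i : Fin d) {f g : EuclideanSpace ℝ (Fin d) → ℝ}
    (hf : ContDiff ℝ (⊤ : ℕ∞) f) (hg : ContDiff ℝ (⊤ : ℕ∞) g) (x : EuclideanSpace ℝ (Fin d)) :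
    pd i (fun y => f y - g y) x = pd i f x - pd i g x := by
  unfold pd
  rw [fderiv_fun_sub (hf.differentiable (by simp) x) (hg.differentiable (by simp) x)]
  simp

theorem pd_lin {d : ℕ} (i : Fin d) {f g : EuclideanSpace ℝ (Fin d) → ℝ} (a b : ℝ)
    (hf : ContDiff ℝ (⊤ : ℕ∞) f) (hg : ContDiff ℝ (⊤ : ℕ∞) g) (x : EuclideanSpace ℝ (Fin d)) :
    pd i (fun y => a * f y + b * g y) x = a * pd i f x + b * pd i g x := by
  unfold pd
  have h1 := hf.differentiable (by simp) x
  have h2 := hg.differentiable (by simp) x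
  rw [fderiv_fun_add (h1.const_mul a) (h2.const_mul b), fderiv_const_mul h1, fderiv_const_mul h2]
  simp

theorem unitCube_preimage (d : ℕ) :
    (WithLp.toLp 2 : (Fin d → ℝ) → EuclideanSpace ℝ (Fin d)) ⁻¹' unitCube d
      = Set.Icc (0 : Fin d → ℝ) 1 := by
  ext x
  simp [unitCube, Pi.le_def, forall_and]

theorem unitCube_compact (d : ℕ) : IsCompact (unitCube d) := by
  have h : unitCube d = (WithLp.toLp 2 : (Fin d → ℝ) → EuclideanSpace ℝ (Fin d)) ''
      Set.Icc (0 : Fin d → ℝ) 1 := by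
    rw [← unitCube_preimage, Set.image_preimage_eq]
    exact (WithLp.toLp_surjective 2)
  rw [h]
  exact isCompact_Icc.image (PiLp.continuous_toLp 2 _)

theorem integral_div_zero (d : ℕ) (V : Fin d → EuclideanSpace ℝ (Fin d) → ℝ)
    (hV : ∀ i, ContDiff ℝ (⊤ : ℕ∞) (V i))
    (hp : ∀ i x j, V i (x + EuclideanSpace.single j 1) = V i x) :
    ∫ x in unitCube d, ∑ i, pd i (V i) x = 0 := by
  cases d with
  | zero => simp
  | succ n =>
    rw [← (PiLp.volume_preserving_toLp (Fin (n+1))).setIntegral_preimage_emb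
      (MeasurableEquiv.toLp 2 (Fin (n+1) → ℝ)).measurableEmbedding, unitCube_preimage]
    let L : (Fin (n+1) → ℝ) →L[ℝ] EuclideanSpace ℝ (Fin (n+1)) :=
      (PiLp.continuousLinearEquiv 2 ℝ (fun _ : Fin (n+1) => ℝ)).symm
    have hd : ∀ i x, HasFDerivAt (fun x : Fin (n+1) → ℝ => V i (WithLp.toLp 2 x))
        ((fderiv ℝ (V i) (WithLp.toLp 2 x)).comp L) x := by
      intro i x
      have h1 : HasFDerivAt (V i) (fderiv ℝ (V i) (L x)) (L x) :=
        ((hV i).differentiable (by simp) _).hasFDerivAt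
      exact h1.comp x L.hasFDerivAt
    have key := integral_divergence_of_hasFDerivAt_off_countable' (0 : Fin (n+1) → ℝ) 1
      (fun i => by simp)
      (fun i x => V i (WithLp.toLp 2 x))
      (fun i x => (fderiv ℝ (V i) (WithLp.toLp 2 x)).comp L) ∅ Set.countable_empty
      (fun i => (continuous_iff_continuousAt.2 fun x => (hd i x).continuousAt).continuousOn)
      (fun x _ i => hd i x)
      (by
        apply ContinuousOn.integrableOn_compact isCompact_Icc
        apply Continuous.continuousOn
        refine continuous_finset_sum _ fun i _ => ?_
        exact (pd_contDiff i (hV i)).continuous.comp (PiLp.continuous_toLp 2 _))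
    refine Eq.trans key ?_
    refine Finset.sum_eq_zero fun i _ => ?_
    rw [sub_eq_zero]
    congr 1
    funext x
    have h := hp i (WithLp.toLp 2 (i.insertNth (0:ℝ) x)) i
    refine Eq.trans ?_ h
    simp only [Pi.one_apply]
    congr 1
    ext j
    refine Fin.succAboveCases i ?_ (fun k => ?_) j
    · simp
    · simp

theorem convex_tangent {f : ℝ → ℝ} (hc : ConvexOn ℝ Set.univ f) (hf : ContDiff ℝ 1 f) (a b : ℝ) :
    f a + deriv f a * (b - a) ≤ f b := by
  have hd : DifferentiableAt ℝ f a := hf.differentiable (by simp) a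
  rcases lt_trichotomy a b with h | h | h
  · have := hc.deriv_le_slope trivial trivial h hd
    rw [slope_def_field, le_div_iff₀ (by linarith)] at this
    linarith
  · subst h; simp
  · have := hc.slope_le_deriv trivial trivial h hd
    rw [slope_def_field, div_le_iff₀ (by linarith)] at this
    linarith

/-- Unconditional energy stability of the convex-splitting scheme for the Cahn–Hilliard
equation on the torus: if `Ψ = Ψ_c + Ψ_e` with `Ψ_c, -Ψ_e` convex and `C¹`, and smooth
periodic `φⁿ, φⁿ⁺¹, μ` satisfy `(φⁿ⁺¹-φⁿ)/τ = Δμ`,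
`μ = Ψ_c'(φⁿ⁺¹) + Ψ_e'(φⁿ) - ε²Δφⁿ⁺¹`, then `E(φⁿ⁺¹) ≤ E(φⁿ)` for any step size `τ > 0`,
where `E(φ) = ∫ Ψ(φ) + (ε²/2)|∇φ|² dx`. -/
theorem stmt_12 (d : ℕ) (ε τ : ℝ) (hε : 0 < ε) (hτ : 0 < τ)
    (Ψc Ψe : ℝ → ℝ)
    (hΨcConv : ConvexOn ℝ Set.univ Ψc) (hΨeConc : ConvexOn ℝ Set.univ fun s => -Ψe s)
    (hΨc : ContDiff ℝ 1 Ψc) (hΨe : ContDiff ℝ 1 Ψe)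
    (φn φn1 μ : EuclideanSpace ℝ (Fin d) → ℝ)
    (hφn : ContDiff ℝ (⊤ : ℕ∞) φn) (hφn1 : ContDiff ℝ (⊤ : ℕ∞) φn1) (hμ : ContDiff ℝ (⊤ : ℕ∞) μ)
    (hφnper : ∀ x i, φn (x + EuclideanSpace.single i 1) = φn x)
    (hφn1per : ∀ x i, φn1 (x + EuclideanSpace.single i 1) = φn1 x)
    (hμper : ∀ x i, μ (x + EuclideanSpace.single i 1) = μ x)
    (hscheme : ∀ x, (φn1 x - φn x) / τ = ∑ i, pd i (fun y => pd i μ y) x)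
    (hpot : ∀ x, μ x = deriv Ψc (φn1 x) + deriv Ψe (φn x)
      - ε ^ 2 * ∑ i, pd i (fun y => pd i φn1 y) x) :
    (∫ x in unitCube d,
        (Ψc (φn1 x) + Ψe (φn1 x) + ε ^ 2 / 2 * ∑ i, (pd i φn1 x) ^ 2))
      ≤ ∫ x in unitCube d,
        (Ψc (φn x) + Ψe (φn x) + ε ^ 2 / 2 * ∑ i, (pd i φn x) ^ 2) := by
  have h1 := hφn.continuous
  have h2 := hφn1.continuous
  have c1 := hΨc.continuous
  have c2 := hΨe.continuous
  have p1 := fun i => (pd_contDiff i hφn).continuous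
  have p2 := fun i => (pd_contDiff i hφn1).continuous
  have hint : ∀ {g : EuclideanSpace ℝ (Fin d) → ℝ}, Continuous g →
      IntegrableOn g (unitCube d) := fun hg =>
    hg.continuousOn.integrableOn_compact (unitCube_compact d)
  let V : Fin d → EuclideanSpace ℝ (Fin d) → ℝ := fun i y =>
    τ * (μ y * pd i μ y) + ε ^ 2 * ((φn1 y - φn y) * pd i φn1 y)
  have s1 := fun i => hμ.mul (pd_contDiff i hμ)
  have s2 := fun i => (hφn1.sub hφn).mul (pd_contDiff i hφn1)
  have hV : ∀ i, ContDiff ℝ (⊤ : ℕ∞) (V i) := fun i =>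
    (contDiff_const.mul (s1 i)).add (contDiff_const.mul (s2 i))
  have hV0 := integral_div_zero d V hV (by
    intro i x j
    simp only [V, hμper, hφnper, hφn1per, pd_per _ hμper, pd_per _ hφn1per])
  have hpdV : ∀ i x, pd i (V i) x = τ * (μ x * pd i (fun y => pd i μ y) x + pd i μ x * pd i μ x)
      + ε ^ 2 * ((φn1 x - φn x) * pd i (fun y => pd i φn1 y) x
        + pd i φn1 x * (pd i φn1 x - pd i φn x)) := by
    intro i x
    have := pd_lin i τ (ε ^ 2) (s1 i) (s2 i) x
    refine this.trans ?_
    congr 2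
    · exact pd_mul i hμ (pd_contDiff i hμ) x
    · refine (pd_mul i (hφn1.sub hφn) (pd_contDiff i hφn1) x).trans ?_
      rw [← pd_sub i hφn1 hφn]
  have cV : Continuous fun x => ∑ i, pd i (V i) x :=
    continuous_finset_sum _ fun i _ => (pd_contDiff i (hV i)).continuous
  have cB : Continuous fun x => Ψc (φn x) + Ψe (φn x) + ε ^ 2 / 2 * ∑ i, (pd i φn x) ^ 2 := by
    fun_prop
  have cA : Continuous fun x => Ψc (φn1 x) + Ψe (φn1 x) + ε ^ 2 / 2 * ∑ i, (pd i φn1 x) ^ 2 := by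
    fun_prop
  rw [← add_zero (∫ x in unitCube d,
        (Ψc (φn x) + Ψe (φn x) + ε ^ 2 / 2 * ∑ i, (pd i φn x) ^ 2)), ← hV0,
    ← integral_add (hint cB) (hint cV)]
  refine integral_mono (hint cA) (hint (cB.add cV)) fun x => ?_
  have t1 := convex_tangent hΨcConv hΨc (φn1 x) (φn x)
  have t2 := convex_tangent hΨeConc hΨe.neg (φn x) (φn1 x)
  rw [deriv.fun_neg] at t2
  have e1 : φn1 x - φn x = τ * ∑ i, pd i (fun y => pd i μ y) x := by
    rw [← hscheme x]; field_simp
  have e2 := hpot x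
  have e3 : ∑ i, pd i (V i) x = τ * (μ x * ∑ i, pd i (fun y => pd i μ y) x)
      + τ * ∑ i, pd i μ x ^ 2
      + ε ^ 2 * ((φn1 x - φn x) * ∑ i, pd i (fun y => pd i φn1 y) x)
      + ε ^ 2 * ∑ i, pd i φn1 x * (pd i φn1 x - pd i φn x) := by
    simp only [hpdV, Finset.mul_sum, ← Finset.sum_add_distrib]
    exact Finset.sum_congr rfl fun i _ => by ring
  have e4 : ε ^ 2 / 2 * ∑ i, (pd i φn1 x) ^ 2 ≤ ε ^ 2 / 2 * ∑ i, (pd i φn x) ^ 2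
      + ε ^ 2 * ∑ i, pd i φn1 x * (pd i φn1 x - pd i φn x) := by
    simp only [Finset.mul_sum, ← Finset.sum_add_distrib]
    refine Finset.sum_le_sum fun i _ => ?_
    nlinarith [mul_nonneg (sq_nonneg ε) (sq_nonneg (pd i φn1 x - pd i φn x))]
  have e5 : 0 ≤ τ * ∑ i, pd i μ x ^ 2 :=
    mul_nonneg hτ.le (Finset.sum_nonneg fun i _ => sq_nonneg _)
  have e6 : τ * (μ x * ∑ i, pd i (fun y => pd i μ y) x) = (φn1 x - φn x) * μ x := by
    rw [e1]; ring
  have e7 : (φn1 x - φn x) * μ x = (φn1 x - φn x) * (deriv Ψc (φn1 x) + deriv Ψe (φn x))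
      - ε ^ 2 * ((φn1 x - φn x) * ∑ i, pd i (fun y => pd i φn1 y) x) := by
    rw [e2]; ring
  simp only
  rw [e3, e6, e7]
  linarith
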